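/- arXiv:1608.00451 — 2 statements merged into one kernel-verified Lean document; each statement's English description precedes it below -/
import Mathlib

section
/- Let A ∈ ℂ^{n×n} and B ∈ ℂ^{l×l} be Hermitian matrices, let H ∈ ℂ^{n×l} have orthonormal columns, and define F = A H − H B. Let μ₁, …, μ_l be the eigenvalues of B listed with multiplicity. Then there exist l eigenvalues λ₁, …, λ_l of A (i.e., an injective assignment i ↦ λ_i from {1,…,l} into the multiset of eigenvalues of A counted with multiplicity) such that |λᵢ − μᵢ| ≤ ‖F‖₂ for every i = 1, …, l. -/
open Matrix

/-- The spectral norm (largest singular value) of a matrix over `ℝ` or `ℂ`, realized as the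
`ℓ²`-operator norm of the associated linear map between Euclidean spaces. -/
noncomputable def specNorm {m n : ℕ} {𝕜 : Type*} [RCLike 𝕜] (M : Matrix (Fin m) (Fin n) 𝕜) : ℝ :=
  ‖LinearMap.toContinuousLinearMap (Matrix.toEuclideanLin M)‖

/-- Hall's condition for interval neighbourhoods. -/
lemma kahan_hall {n l : ℕ} (u : Fin l → ℝ) (v : Fin n → ℝ) (δ : ℝ)
    (h : ∀ a b : ℝ, a ≤ b → (Finset.univ.filter fun i => a ≤ u i ∧ u i ≤ b).card ≤
      (Finset.univ.filter fun j => a - δ ≤ v j ∧ v j ≤ b + δ).card) (S : Finset (Fin l)) :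
    S.card ≤ (Finset.univ.filter fun j => ∃ i ∈ S, |v j - u i| ≤ δ).card := by
  induction S using Finset.strongInduction with
  | H S ih =>
    rcases S.eq_empty_or_nonempty with rfl | hS
    · simp
    obtain ⟨p, hp, hpm⟩ := S.exists_min_image u hS
    obtain ⟨q, hq, hqm⟩ := S.exists_max_image u hS
    by_cases hg : ∃ j, (u p - δ ≤ v j ∧ v j ≤ u q + δ) ∧ ∀ i ∈ S, δ < |v j - u i|
    · obtain ⟨j, ⟨h1, h2⟩, h3⟩ := hg
      have hp1 : u p + δ < v j := by
        have := h3 p hp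
        rw [lt_abs] at this
        rcases this with h | h <;> linarith
      have hq1 : v j < u q - δ := by
        have := h3 q hq
        rw [lt_abs] at this
        rcases this with h | h <;> linarith
      have hd := Finset.card_filter_add_card_filter_not (s := S) (fun i => u i < v j - δ)
      have i1 := ih (S.filter fun i => u i < v j - δ)
        (Finset.filter_ssubset.2 ⟨q, hq, by
          by_contra hc
          have := hpm q hq
          have := h3 q hq
          rw [lt_abs] at this
          rcases this with h | h <;> linarith⟩)
      have i2 := ih (S.filter fun i => ¬ u i < v j - δ)
        (Finset.filter_ssubset.2 ⟨p, hp, by rw [not_not]; linarith⟩)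
      rw [← hd]
      refine (add_le_add i1 i2).trans ?_
      rw [← Finset.card_union_of_disjoint]
      · apply Finset.card_le_card
        intro k
        simp only [Finset.mem_union, Finset.mem_filter, Finset.mem_univ, true_and]
        rintro (⟨i, ⟨hi, _⟩, hk⟩ | ⟨i, ⟨hi, _⟩, hk⟩) <;> exact ⟨i, hi, hk⟩
      · rw [Finset.disjoint_left]
        intro k
        simp only [Finset.mem_filter, Finset.mem_univ, true_and]
        rintro ⟨i, ⟨hi, hi1⟩, hk⟩ ⟨i', ⟨hi', hi1'⟩, hk'⟩
        rw [abs_le] at hk hk'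
        have := h3 i' hi'
        rw [lt_abs] at this
        rcases this with h | h <;> linarith [hk.1, hk.2, hk'.1, hk'.2]
    · push Not at hg
      have := h (u p) (u q) (hpm q hq)
      refine le_trans (le_trans (Finset.card_le_card ?_) this) (Finset.card_le_card ?_)
      · intro i hi
        simp [hpm i hi, hqm i hi]
      · intro j
        simp only [Finset.mem_filter, Finset.mem_univ, true_and]
        exact fun hj => hg j hj

lemma kahan_norm {n : ℕ} (A : Matrix (Fin n) (Fin n) ℂ) (hA : A.IsHermitian) (c : ℝ)
    (x : EuclideanSpace ℂ (Fin n)) :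
    ‖toEuclideanLin A x - (c : ℂ) • x‖ ^ 2 =
      ∑ j, (hA.eigenvalues j - c) ^ 2 * ‖inner ℂ (hA.eigenvectorBasis j) x‖ ^ 2 := by
  rw [← hA.eigenvectorBasis.sum_sq_norm_inner_right]
  refine Finset.sum_congr rfl fun j _ => ?_
  have hs : (toEuclideanLin A).IsSymmetric := isSymmetric_toEuclideanLin_iff.2 hA
  have he : toEuclideanLin A (hA.eigenvectorBasis j) =
      (hA.eigenvalues j : ℂ) • hA.eigenvectorBasis j := by
    apply (WithLp.ofLp_injective 2)
    have := hA.mulVec_eigenvectorBasis j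
    simpa using this
  rw [inner_sub_right, ← hs, he, inner_smul_left, inner_smul_right, ← sub_mul, norm_mul, mul_pow]
  congr 1
  rw [Complex.conj_ofReal, ← Complex.ofReal_sub, Complex.norm_real, Real.norm_eq_abs, sq_abs]

lemma kahan_count {n l : ℕ}
    (A : Matrix (Fin n) (Fin n) ℂ) (hA : A.IsHermitian)
    (B : Matrix (Fin l) (Fin l) ℂ) (hB : B.IsHermitian)
    (H : Matrix (Fin n) (Fin l) ℂ) (hH : Hᴴ * H = 1)
    (F : Matrix (Fin n) (Fin l) ℂ) (hF : F = A * H - H * B) (a b : ℝ) (hab : a ≤ b) :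
    (Finset.univ.filter fun i => a ≤ hB.eigenvalues i ∧ hB.eigenvalues i ≤ b).card ≤
      (Finset.univ.filter fun j => a - specNorm F ≤ hA.eigenvalues j ∧
        hA.eigenvalues j ≤ b + specNorm F).card := by
  set S := Finset.univ.filter fun i => a ≤ hB.eigenvalues i ∧ hB.eigenvalues i ≤ b with hS
  set T := Finset.univ.filter fun j => a - specNorm F ≤ hA.eigenvalues j ∧
        hA.eigenvalues j ≤ b + specNorm F with hT
  have hδ : 0 ≤ specNorm F := norm_nonneg _
  by_contra! hlt
  let Φ : EuclideanSpace ℂ (Fin l) →ₗ[ℂ] ((Sᶜ : Finset (Fin l)) → ℂ) × (T → ℂ) :=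
    LinearMap.prod (LinearMap.pi fun i => (innerSL ℂ (hB.eigenvectorBasis i)).toLinearMap)
      (LinearMap.pi fun j => (innerSL ℂ (hA.eigenvectorBasis j)).toLinearMap ∘ₗ toEuclideanLin H)
  have hk : LinearMap.ker Φ ≠ ⊥ := by
    apply LinearMap.ker_ne_bot_of_finrank_lt
    have hc := Finset.card_add_card_compl S
    simp only [Fintype.card_fin] at hc
    simp only [Module.finrank_prod, Module.finrank_fintype_fun_eq_card, Fintype.card_coe,
      finrank_euclideanSpace, Fintype.card_fin]
    omega
  obtain ⟨x, hx, hx0⟩ := Submodule.exists_mem_ne_zero_of_ne_bot hk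
  rw [LinearMap.mem_ker] at hx
  have hx1 : ∀ i ∉ S, inner ℂ (hB.eigenvectorBasis i) x = 0 := fun i hi =>
    congrFun (congrArg Prod.fst hx) ⟨i, Finset.mem_compl.2 hi⟩
  have hx2 : ∀ j ∈ T, inner ℂ (hA.eigenvectorBasis j) (toEuclideanLin H x) = 0 := fun j hj =>
    congrFun (congrArg Prod.snd hx) ⟨j, hj⟩
  set c := (a + b) / 2 with hc
  set r := (b - a) / 2 with hr
  have hr0 : 0 ≤ r := by rw [hr]; linarith
  have hiso : ∀ z : EuclideanSpace ℂ (Fin l), ‖toEuclideanLin H z‖ = ‖z‖ := by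
    intro z
    have : inner ℂ (toEuclideanLin H z) (toEuclideanLin H z) = inner ℂ z z := by
      rw [← LinearMap.adjoint_inner_right, ← toEuclideanLin_conjTranspose_eq_adjoint]
      congr 1
      apply (WithLp.ofLp_injective 2)
      simp [hH]
    rw [inner_self_eq_norm_sq_to_K, inner_self_eq_norm_sq_to_K] at this
    have h2 : ‖toEuclideanLin H z‖ ^ 2 = ‖z‖ ^ 2 := by exact_mod_cast this
    exact (sq_eq_sq₀ (norm_nonneg _) (norm_nonneg _)).1 h2
  have hBx : ‖toEuclideanLin B x - (c : ℂ) • x‖ ≤ r * ‖x‖ := by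
    rw [← sq_le_sq₀ (norm_nonneg _) (by positivity), kahan_norm B hB c x, mul_pow,
      ← hB.eigenvectorBasis.sum_sq_norm_inner_right x, Finset.mul_sum]
    refine Finset.sum_le_sum fun i _ => ?_
    by_cases hi : i ∈ S
    · apply mul_le_mul_of_nonneg_right _ (by positivity)
      obtain ⟨h1, h2⟩ := (Finset.mem_filter.1 hi).2
      rw [sq_le_sq, abs_of_nonneg hr0, abs_le]
      constructor <;> linarith
    · simp [hx1 i hi]
  have hFx : ‖toEuclideanLin F x‖ ≤ specNorm F * ‖x‖ :=
    (LinearMap.toContinuousLinearMap (Matrix.toEuclideanLin F)).le_opNorm x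
  have hup : ‖toEuclideanLin A (toEuclideanLin H x) - (c : ℂ) • toEuclideanLin H x‖ ≤
      (r + specNorm F) * ‖x‖ := by
    have : toEuclideanLin A (toEuclideanLin H x) - (c : ℂ) • toEuclideanLin H x =
        toEuclideanLin H (toEuclideanLin B x - (c : ℂ) • x) + toEuclideanLin F x := by
      rw [map_sub, map_smul, hF]
      apply (WithLp.ofLp_injective 2)
      simp
    rw [this]
    refine (norm_add_le _ _).trans ?_
    rw [hiso, add_mul]
    exact add_le_add hBx hFx
  refine absurd hup (not_le.2 ?_)
  set y := toEuclideanLin H x with hy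
  have hy0 : y ≠ 0 := by
    rw [← norm_ne_zero_iff, hiso, norm_ne_zero_iff]; exact hx0
  rw [← hiso x, ← sq_lt_sq₀ (by positivity) (norm_nonneg _), kahan_norm A hA c y, mul_pow,
      ← hA.eigenvectorBasis.sum_sq_norm_inner_right y, Finset.mul_sum]
  have key : ∀ j ∉ T, (r + specNorm F) ^ 2 < (hA.eigenvalues j - c) ^ 2 := by
    intro j hj
    rw [hT, Finset.mem_filter] at hj
    rw [sq_lt_sq, abs_of_nonneg (by positivity : 0 ≤ r + specNorm F), lt_abs]
    by_contra! h
    exact hj ⟨Finset.mem_univ _, by linarith [h.2], by linarith [h.1]⟩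
  apply Finset.sum_lt_sum
  · intro j _
    by_cases hj : j ∈ T
    · simp [hx2 j hj]
    · exact mul_le_mul_of_nonneg_right (key j hj).le (by positivity)
  · by_contra! hall
    apply hy0
    rw [← norm_eq_zero, ← sq_eq_zero_iff, ← hA.eigenvectorBasis.sum_sq_norm_inner_right y]
    refine Finset.sum_eq_zero fun j _ => ?_
    by_cases hj : j ∈ T
    · simp [hx2 j hj]
    · by_contra hne
      have hpos : 0 < ‖inner ℂ (hA.eigenvectorBasis j) y‖ ^ 2 :=
        lt_of_le_of_ne (by positivity) (Ne.symm hne)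
      exact absurd (hall j (Finset.mem_univ _))
        (not_le.2 (mul_lt_mul_of_pos_right (key j hj) hpos))

/-- **Kahan's eigenvalue residual theorem.**  Let `A ∈ ℂ^{n×n}` and `B ∈ ℂ^{l×l}` be Hermitian,
let `H ∈ ℂ^{n×l}` have orthonormal columns, and define `F = A H - H B`.  Then to the
eigenvalues `μ₁, …, μ_l` of `B` there correspond `l` eigenvalues `λ₁, …, λ_l` of `A` (an
injective assignment into the multiset of eigenvalues of `A` counted with multiplicity) such
that `|λᵢ - μᵢ| ≤ ‖F‖₂` for every `i`. -/
theorem kahan_residual_bound {n l : ℕ}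
    (A : Matrix (Fin n) (Fin n) ℂ) (hA : A.IsHermitian)
    (B : Matrix (Fin l) (Fin l) ℂ) (hB : B.IsHermitian)
    (H : Matrix (Fin n) (Fin l) ℂ) (hH : Hᴴ * H = 1)
    (F : Matrix (Fin n) (Fin l) ℂ) (hF : F = A * H - H * B) :
    ∃ f : Fin l → Fin n, Function.Injective f ∧
      ∀ i : Fin l, |hA.eigenvalues (f i) - hB.eigenvalues i| ≤ specNorm F := by
  have h0 := kahan_hall hB.eigenvalues hA.eigenvalues (specNorm F)
    (fun a b hab => kahan_count A hA B hB H hH F hF a b hab)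
  classical
  refine (Fintype.all_card_le_filter_rel_iff_exists_injective
    (fun (i : Fin l) (j : Fin n) => |hA.eigenvalues j - hB.eigenvalues i| ≤ specNorm F)).1 ?_
  intro S
  convert h0 S
end

section
/- There exists a constant C₁ > 0 such that for all n ≥ d ≥ 1 and all n×d real matrices U and Û, each with orthonormal columns, there exists a d×d real orthogonal matrix W such that ‖U W − Û‖_F ≤ C₁ ‖U Uᵀ − Û Ûᵀ‖_F. -/
open scoped BigOperators
open Matrix

/-- The Frobenius norm of a real matrix. -/
noncomputable def frobNorm {m n : Type*} [Fintype m] [Fintype n] (M : Matrix m n ℝ) : ℝ :=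
  Real.sqrt (∑ i, ∑ j, (M i j) ^ 2)

lemma frob_trace {m n : Type*} [Fintype m] [Fintype n] (M : Matrix m n ℝ) :
    frobNorm M = Real.sqrt (trace (Mᵀ * M)) := by
  unfold frobNorm
  congr 1
  rw [Finset.sum_comm]
  simp [trace, Matrix.mul_apply, pow_two]

lemma exists_Q (d : ℕ) (B : Matrix (Fin d) (Fin d) ℝ) (l : Fin d → ℝ)
    (hB : Bᵀ * B = diagonal l) (hl : ∀ i, l i ≤ 1) :
    ∃ Q : Matrix (Fin d) (Fin d) ℝ, Qᵀ * Q = 1 ∧ trace (Bᵀ * B) ≤ trace (Qᵀ * B) := by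
  have hent : ∀ i j, ∑ k, B k i * B k j = if i = j then l i else 0 := by
    intro i j
    have := congrFun (congrFun hB i) j
    simpa [Matrix.mul_apply, diagonal_apply] using this
  have hl0 : ∀ i, 0 ≤ l i := by
    intro i
    have := hent i i
    simp only [if_true] at this
    rw [← this]
    exact Finset.sum_nonneg fun k _ => mul_self_nonneg _
  let v : Fin d → EuclideanSpace ℝ (Fin d) :=
    fun i => WithLp.toLp 2 (fun k => (Real.sqrt (l i))⁻¹ * B k i)
  have hv : Orthonormal ℝ (({i | l i ≠ 0} : Set (Fin d)).domRestrict v) := by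
    rw [orthonormal_iff_ite]
    rintro ⟨i, hi⟩ ⟨j, hj⟩
    have h1 : inner ℝ (v i) (v j)
        = (Real.sqrt (l i))⁻¹ * (Real.sqrt (l j))⁻¹ * ∑ k, B k i * B k j := by
      simp only [v, PiLp.inner_apply, Finset.mul_sum]
      refine Finset.sum_congr rfl fun k _ => ?_
      simp
      ring
    simp only [Subtype.mk.injEq]
    change inner ℝ (v i) (v j) = _
    rw [h1, hent]
    split_ifs with h
    · subst h
      have : Real.sqrt (l i) ≠ 0 := by
        rw [Real.sqrt_ne_zero (hl0 i)]; exact hi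
      have h2 := Real.mul_self_sqrt (hl0 i)
      field_simp
      rw [pow_two, h2]
    · simp
  obtain ⟨b, hb⟩ := hv.exists_orthonormalBasis_extension_of_card_eq (by simp)
  refine ⟨Matrix.of fun k i => b i k, ?_, ?_⟩
  · ext i j
    have := orthonormal_iff_ite.1 b.orthonormal i j
    simp only [PiLp.inner_apply] at this
    simp only [Matrix.mul_apply, transpose_apply, of_apply, Matrix.one_apply]
    rw [← this]
    refine Finset.sum_congr rfl fun k _ => ?_
    simp [mul_comm]
  · rw [hB]
    simp only [trace, diag_apply, diagonal_apply_eq]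
    refine Finset.sum_le_sum fun i _ => ?_
    simp only [Matrix.mul_apply, transpose_apply, of_apply]
    have hii := hent i i
    simp only [if_true] at hii
    by_cases h : l i = 0
    · rw [h] at hii ⊢
      rw [Finset.sum_eq_zero_iff_of_nonneg (fun k _ => mul_self_nonneg _)] at hii
      refine le_of_eq (Eq.symm (Finset.sum_eq_zero fun k hk => ?_))
      rw [mul_self_eq_zero.1 (hii k hk), mul_zero]
    · rw [hb i h]
      have : ∑ k, (v i) k * B k i = (Real.sqrt (l i))⁻¹ * l i := by
        rw [← hii, Finset.mul_sum]
        rw [hii]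
        refine Finset.sum_congr rfl fun k _ => ?_
        simp only [v]
        ring
      rw [this]
      have h0 : 0 < Real.sqrt (l i) := Real.sqrt_pos.2 (lt_of_le_of_ne (hl0 i) (Ne.symm h))
      have h1 : Real.sqrt (l i) ≤ 1 := Real.sqrt_le_one.2 (hl i)
      have h2 : 1 ≤ (Real.sqrt (l i))⁻¹ := (one_le_inv₀ h0).2 h1
      nlinarith [hl0 i]

/-- There exists a constant `C₁ > 0` such that for all `n ≥ d ≥ 1` and all `n × d` real
matrices `U` and `Û` with orthonormal columns, there is a `d × d` real orthogonal matrix `W`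
with `‖U W - Û‖_F ≤ C₁ ‖U Uᵀ - Û Ûᵀ‖_F`. -/
theorem exists_orthogonal_alignment :
    ∃ C₁ : ℝ, 0 < C₁ ∧
      ∀ (n d : ℕ), 1 ≤ d → d ≤ n →
        ∀ (U Uhat : Matrix (Fin n) (Fin d) ℝ),
          Uᵀ * U = 1 → Uhatᵀ * Uhat = 1 →
          ∃ W : Matrix (Fin d) (Fin d) ℝ, Wᵀ * W = 1 ∧
            frobNorm (U * W - Uhat) ≤ C₁ * frobNorm (U * Uᵀ - Uhat * Uhatᵀ) := by
  refine ⟨1, one_pos, ?_⟩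
  intro n d _ _ U X hU hX
  obtain ⟨A, hA⟩ : ∃ A, A = Uᵀ * X := ⟨_, rfl⟩
  have hAt : Aᵀ = Xᵀ * U := by rw [hA]; simp
  have hG : (Aᵀ * A).IsHermitian := by
    simp [Matrix.IsHermitian, conjTranspose_eq_transpose_of_trivial]
  obtain ⟨V, l, hV, hV', hD⟩ : ∃ (V : Matrix (Fin d) (Fin d) ℝ) (l : Fin d → ℝ),
      Vᵀ * V = 1 ∧ V * Vᵀ = 1 ∧ (A * V)ᵀ * (A * V) = diagonal l := by
    let V : Matrix (Fin d) (Fin d) ℝ := hG.eigenvectorUnitary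
    have e : star V = Vᵀ := by
      rw [star_eq_conjTranspose, conjTranspose_eq_transpose_of_trivial]
    have h1 : Vᵀ * V = 1 := by rw [← e]; exact Unitary.coe_star_mul_self hG.eigenvectorUnitary
    have h2 : V * Vᵀ = 1 := by rw [← e]; exact Unitary.coe_mul_star_self hG.eigenvectorUnitary
    refine ⟨V, hG.eigenvalues, h1, h2, ?_⟩
    have h3 : Aᵀ * A = V * diagonal hG.eigenvalues * Vᵀ := by
      have := hG.spectral_theorem
      rw [Unitary.conjStarAlgAut_apply] at this
      rw [← e]
      exact this
    generalize hG.eigenvalues = m at h3 ⊢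
    calc (A * V)ᵀ * (A * V) = Vᵀ * (Aᵀ * A) * V := by
          simp only [transpose_mul, Matrix.mul_assoc]
      _ = (Vᵀ * V) * diagonal m * (Vᵀ * V) := by
          rw [h3]; simp only [Matrix.mul_assoc]
      _ = _ := by rw [h1]; simp
  have hl : ∀ i, l i ≤ 1 := by
    intro i
    obtain ⟨Y, hY⟩ : ∃ Y, Y = X * V - U * (A * V) := ⟨_, rfl⟩
    have key : Yᵀ * Y = 1 - diagonal l := by
      have a1 : (X * V)ᵀ * (X * V) = 1 := by
        calc _ = Vᵀ * (Xᵀ * X) * V := by simp only [transpose_mul, Matrix.mul_assoc]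
          _ = 1 := by rw [hX]; simp [hV]
      have a2 : (X * V)ᵀ * (U * (A * V)) = diagonal l := by
        rw [← hD]
        simp only [transpose_mul, hAt, Matrix.mul_assoc]
      have a3 : (U * (A * V))ᵀ * (X * V) = diagonal l := by
        rw [← hD]
        simp only [transpose_mul, hA, Matrix.mul_assoc]
      have a4 : (U * (A * V))ᵀ * (U * (A * V)) = diagonal l := by
        calc _ = (A * V)ᵀ * (Uᵀ * U) * (A * V) := by
              rw [transpose_mul U]; simp only [Matrix.mul_assoc]
          _ = _ := by rw [hU, Matrix.mul_one, hD]
      rw [hY, transpose_sub, Matrix.sub_mul, Matrix.mul_sub, Matrix.mul_sub, a1, a2, a3, a4]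
      abel
    have := congrFun (congrFun key i) i
    simp only [Matrix.mul_apply, transpose_apply, Matrix.sub_apply, one_apply_eq,
      diagonal_apply_eq] at this
    have h0 : 0 ≤ ∑ k, Y k i * Y k i := Finset.sum_nonneg fun k _ => mul_self_nonneg _
    linarith
  obtain ⟨Q, hQ, hT⟩ := exists_Q d (A * V) l hD hl
  have hW : (Q * Vᵀ)ᵀ * (Q * Vᵀ) = 1 := by
    calc _ = V * (Qᵀ * Q) * Vᵀ := by
          simp only [transpose_mul, transpose_transpose, Matrix.mul_assoc]
      _ = 1 := by rw [hQ]; simp [hV']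
  refine ⟨Q * Vᵀ, hW, ?_⟩
  have t1 : trace ((A * V)ᵀ * (A * V)) = trace (Aᵀ * A) := by
    have : A * V * (A * V)ᵀ = A * (V * Vᵀ) * Aᵀ := by
      simp only [transpose_mul, Matrix.mul_assoc]
    rw [trace_mul_comm, this, hV', Matrix.mul_one, trace_mul_comm]
  have t2 : trace (Qᵀ * (A * V)) = trace ((Q * Vᵀ)ᵀ * A) := by
    rw [← Matrix.mul_assoc, trace_mul_comm, transpose_mul, transpose_transpose, Matrix.mul_assoc]
  rw [t1, t2] at hT
  generalize Q * Vᵀ = W at hW hT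
  rw [one_mul, frob_trace, frob_trace]
  apply Real.sqrt_le_sqrt
  have L : trace ((U * W - X)ᵀ * (U * W - X)) = 2 * d - 2 * trace (Wᵀ * A) := by
    have b1 : (U * W)ᵀ * (U * W) = 1 := by
      calc _ = Wᵀ * (Uᵀ * U) * W := by simp only [transpose_mul, Matrix.mul_assoc]
        _ = 1 := by rw [hU]; simp [hW]
    have b2 : (U * W)ᵀ * X = Wᵀ * A := by rw [hA, transpose_mul, Matrix.mul_assoc]
    have b3 : trace (Xᵀ * (U * W)) = trace (Wᵀ * A) := by
      rw [← b2, ← trace_transpose, transpose_mul, transpose_transpose]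
    rw [transpose_sub, Matrix.sub_mul, Matrix.mul_sub, Matrix.mul_sub, b1, b2, hX]
    simp only [trace_sub, b3, trace_one, Fintype.card_fin]
    ring
  have R : trace ((U * Uᵀ - X * Xᵀ)ᵀ * (U * Uᵀ - X * Xᵀ)) = 2 * d - 2 * trace (Aᵀ * A) := by
    have p1 : ∀ Z : Matrix (Fin n) (Fin d) ℝ, Zᵀ * Z = 1 →
        trace (Z * Zᵀ * (Z * Zᵀ)) = d := by
      intro Z hZ
      have : Z * Zᵀ * (Z * Zᵀ) = Z * (Zᵀ * Z) * Zᵀ := by simp only [Matrix.mul_assoc]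
      rw [this, hZ, Matrix.mul_one, trace_mul_comm, hZ]
      simp
    have p2 : trace (X * Xᵀ * (U * Uᵀ)) = trace (Aᵀ * A) := by
      have : X * Xᵀ * (U * Uᵀ) = X * (Aᵀ * Uᵀ) := by rw [hAt]; simp only [Matrix.mul_assoc]
      rw [this, trace_mul_comm, Matrix.mul_assoc, ← hA]
    have p3 : trace (U * Uᵀ * (X * Xᵀ)) = trace (Aᵀ * A) := by
      rw [trace_mul_comm, p2]
    rw [transpose_sub, transpose_mul, transpose_mul, transpose_transpose, transpose_transpose,
      Matrix.sub_mul, Matrix.mul_sub, Matrix.mul_sub]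
    simp only [trace_sub, p1 U hU, p1 X hX, p2, p3]
    ring
  rw [L, R]
  linarith
end
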